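/- arXiv:math/0609160 — 4 statements merged into one kernel-verified Lean document; each statement's English description precedes it below -/
import Mathlib

section
/- Let X be an ℍ-normed space. Then the restriction map Ψ : T ↦ T|_{X_Re} is an isometric ℝ-linear bijection from the space of bounded ℍ-bimodule maps T : X → ℍ (bounded ℝ-linear maps with T(α • x • β) = α T(x) β for all α, β ∈ ℍ, x ∈ X, with the operator norm) onto the space (X_Re)* of bounded ℝ-linear functionals on X_Re (where ℝ-valued functionals are identified with the real-scalar-valued maps into ℍ). -/
open MulOpposite

local notation "ℍ" => Quaternion ℝ

/-- The standard basis `1, i, j, k` of the quaternions. -/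
noncomputable def qB : Fin 4 → ℍ := ![1, ⟨0,1,0,0⟩, ⟨0,0,1,0⟩, ⟨0,0,0,1⟩]

/-- The real part of an `ℍ`-bimodule, as a set. -/
def reSet (X : Type*) [SMul ℍ X] [SMul ℍᵐᵒᵖ X] : Set X :=
  {x | ∀ α : ℍ, α • x = op α • x}

/-- The real part of an `ℍ`-vector space, as a real submodule. -/
def reSub (X : Type*) [AddCommGroup X] [Module ℝ X] [Module ℍ X] [Module ℍᵐᵒᵖ X]
    [IsScalarTower ℝ ℍ X] [IsScalarTower ℝ ℍᵐᵒᵖ X] : Submodule ℝ X where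
  carrier := reSet X
  add_mem' := fun ha hb α => by rw [smul_add, smul_add, ha α, hb α]
  zero_mem' := fun α => by simp
  smul_mem' := fun r x hx α => by rw [smul_comm, hx α, smul_comm]

/-- The bounded `ℍ`-bimodule maps from an `ℍ`-normed space to `ℍ`, as a real
submodule of the bounded `ℝ`-linear maps. -/
noncomputable def bimodCLM (X : Type*) [NormedAddCommGroup X] [NormedSpace ℝ X]
    [Module ℍ X] [Module ℍᵐᵒᵖ X] : Submodule ℝ (X →L[ℝ] ℍ) where
  carrier := {T | ∀ (α β : ℍ) (x : X), T (α • op β • x) = α * T x * β}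
  add_mem' := fun {S T} hS hT α β x => by
    simp [hS α β x, hT α β x, mul_add, add_mul]
  zero_mem' := fun α β x => by simp
  smul_mem' := fun r T hT α β x => by
    simp [hT α β x, mul_smul_comm, smul_mul_assoc]

@[simp] theorem re_qB_zero : (qB 0).re = 1 := rfl
@[simp] theorem imI_qB_zero : (qB 0).imI = 0 := rfl
@[simp] theorem imJ_qB_zero : (qB 0).imJ = 0 := rfl
@[simp] theorem imK_qB_zero : (qB 0).imK = 0 := rfl
@[simp] theorem re_qB_one : (qB 1).re = 0 := rfl
@[simp] theorem imI_qB_one : (qB 1).imI = 1 := rfl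
@[simp] theorem imJ_qB_one : (qB 1).imJ = 0 := rfl
@[simp] theorem imK_qB_one : (qB 1).imK = 0 := rfl
@[simp] theorem re_qB_two : (qB 2).re = 0 := rfl
@[simp] theorem imI_qB_two : (qB 2).imI = 0 := rfl
@[simp] theorem imJ_qB_two : (qB 2).imJ = 1 := rfl
@[simp] theorem imK_qB_two : (qB 2).imK = 0 := rfl
@[simp] theorem re_qB_three : (qB 3).re = 0 := rfl
@[simp] theorem imI_qB_three : (qB 3).imI = 0 := rfl
@[simp] theorem imJ_qB_three : (qB 3).imJ = 0 := rfl
@[simp] theorem imK_qB_three : (qB 3).imK = 1 := rfl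

theorem quaternion_smul_eq {X : Type*} [AddCommGroup X] [Module ℝ X] [Module ℍ X]
    [IsScalarTower ℝ ℍ X] (α : ℍ) (x : X) :
    α • x = α.re • x + α.imI • qB 1 • x + α.imJ • qB 2 • x + α.imK • qB 3 • x := by
  have h : α = α.re • (1 : ℍ) + α.imI • qB 1 + α.imJ • qB 2 + α.imK • qB 3 := by
    ext <;> simp [Quaternion.re_one, Quaternion.imI_one, Quaternion.imJ_one,
      Quaternion.imK_one]
  conv_lhs => rw [h]
  simp only [add_smul, smul_assoc, one_smul]

theorem op_quaternion_smul_eq {X : Type*} [AddCommGroup X] [Module ℝ X]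
    [Module ℍᵐᵒᵖ X] [IsScalarTower ℝ ℍᵐᵒᵖ X] (α : ℍ) (x : X) :
    op α • x = α.re • x + α.imI • op (qB 1) • x + α.imJ • op (qB 2) • x
      + α.imK • op (qB 3) • x := by
  have h : α = α.re • (1 : ℍ) + α.imI • qB 1 + α.imJ • qB 2 + α.imK • qB 3 := by
    ext <;> simp [Quaternion.re_one, Quaternion.imI_one, Quaternion.imJ_one,
      Quaternion.imK_one]
  conv_lhs => rw [h]
  simp only [op_add, op_smul, op_one, add_smul, smul_assoc, one_smul]

theorem qB_mul_table :
    qB 1 * qB 1 = -1 ∧ qB 2 * qB 2 = -1 ∧ qB 3 * qB 3 = -1 ∧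
    qB 1 * qB 2 = qB 3 ∧ qB 2 * qB 1 = -qB 3 ∧ qB 2 * qB 3 = qB 1 ∧
    qB 3 * qB 2 = -qB 1 ∧ qB 3 * qB 1 = qB 2 ∧ qB 1 * qB 3 = -qB 2 := by
  refine ⟨?_, ?_, ?_, ?_, ?_, ?_, ?_, ?_, ?_⟩ <;> ext <;>
    simp [Quaternion.re_one, Quaternion.imI_one, Quaternion.imJ_one,
      Quaternion.imK_one]

theorem norm_qB (n : Fin 4) : ‖qB n‖ = 1 := by
  have h : ‖qB n‖ * ‖qB n‖ = 1 := by
    rw [← Quaternion.normSq_eq_norm_mul_self, Quaternion.normSq_def']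
    fin_cases n <;> simp
  nlinarith [norm_nonneg (qB n)]

theorem quaternion_ext_re_mul {p q : ℍ} (h : ∀ β : ℍ, (β * p).re = (β * q).re) : p = q := by
  have h0 := h 1
  have h1 := h (qB 1)
  have h2 := h (qB 2)
  have h3 := h (qB 3)
  simp at h0 h1 h2 h3
  ext <;> assumption

section BimoduleRealPart

variable {X : Type*} [NormedAddCommGroup X] [NormedSpace ℝ X] [Module ℍ X] [Module ℍᵐᵒᵖ X]

/-- The average `(x - ixi - jxj - kxk) / 4`. -/
noncomputable def reAverage (x : X) : X :=
  (1 / 4 : ℝ) • (x - qB 1 • op (qB 1) • x - qB 2 • op (qB 2) • x - qB 3 • op (qB 3) • x)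

theorem reAverage_add (x y : X) : reAverage (x + y) = reAverage x + reAverage y := by
  rw [reAverage, reAverage, reAverage, ← smul_add]
  congr 1
  simp only [smul_add]
  abel

theorem norm_reAverage_le (hb : ∀ (α β : ℍ) (x : X), ‖α • op β • x‖ ≤ ‖α‖ * ‖x‖ * ‖β‖) (x : X) :
    ‖reAverage x‖ ≤ ‖x‖ := by
  have h (n : Fin 4) : ‖qB n • op (qB n) • x‖ ≤ ‖x‖ := by
    simpa [norm_qB] using hb (qB n) (qB n) x
  rw [reAverage, norm_smul, Real.norm_of_nonneg (by norm_num)]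
  have h1 := norm_sub_le (x - qB 1 • op (qB 1) • x - qB 2 • op (qB 2) • x) (qB 3 • op (qB 3) • x)
  have h2 := norm_sub_le (x - qB 1 • op (qB 1) • x) (qB 2 • op (qB 2) • x)
  have h3 := norm_sub_le x (qB 1 • op (qB 1) • x)
  linarith [h 1, h 2, h 3]

theorem bimodCLM_smul (T : bimodCLM X) (α : ℍ) (x : X) :
    (T : X →L[ℝ] ℍ) (α • x) = α * (T : X →L[ℝ] ℍ) x := by
  simpa using T.2 α 1 x

theorem bimodCLM_reAverage (T : bimodCLM X) (x : X) :
    (T : X →L[ℝ] ℍ) (reAverage x) = (((T : X →L[ℝ] ℍ) x).re : ℍ) := by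
  have hT (α β : ℍ) : (T : X →L[ℝ] ℍ) (α • op β • x) = α * (T : X →L[ℝ] ℍ) x * β := T.2 α β x
  simp only [reAverage, map_smul, map_sub, hT]
  ext
  all_goals simp
  ring

variable [IsScalarTower ℝ ℍ X] [IsScalarTower ℝ ℍᵐᵒᵖ X]

theorem reAverage_smul (r : ℝ) (x : X) : reAverage (r • x) = r • reAverage x := by
  simp only [reAverage, smul_comm _ r, smul_sub]

theorem reAverage_of_mem {x : X} (hx : x ∈ reSub X) : reAverage x = x := by
  obtain ⟨h1, h2, h3, -⟩ := qB_mul_table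
  have hx' : ∀ α : ℍ, op α • x = α • x := fun α => (hx α).symm
  simp only [reAverage, hx', smul_smul, h1, h2, h3, neg_smul, one_smul]
  module

/-- Restriction of a bimodule map to the real part, as a real functional. -/
noncomputable def reRestrict : bimodCLM X →ₗ[ℝ] (reSub X →L[ℝ] ℝ) where
  toFun T := (innerSL ℝ (1 : ℍ)).comp ((T : X →L[ℝ] ℍ).comp (reSub X).subtypeL)
  map_add' S T := by ext; simp
  map_smul' r T := by ext; simp

theorem reRestrict_apply (T : bimodCLM X) (z : reSub X) :
    reRestrict T z = ((T : X →L[ℝ] ℍ) z).re := by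
  simp [reRestrict, Quaternion.inner_def]

theorem bimodCLM_apply_coe (T : bimodCLM X) (z : reSub X) :
    (T : X →L[ℝ] ℍ) z = ((reRestrict T z : ℝ) : ℍ) := by
  rw [reRestrict_apply, ← bimodCLM_reAverage, reAverage_of_mem z.2]

variable [SMulCommClass ℍ ℍᵐᵒᵖ X]

theorem reAverage_mem (x : X) : reAverage x ∈ reSub X := by
  intro α
  obtain ⟨h1, h2, h3, h4, h5, h6, h7, h8, h9⟩ := qB_mul_table
  have hc (a b : ℍ) (y : X) : op b • a • y = a • op b • y := (smul_comm a (op b) y).symm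
  have hl (a b : ℍ) (y : X) : a • b • y = (a * b) • y := smul_smul a b y
  have hr (a b : ℍ) (y : X) : op a • op b • y = op (b * a) • y := by rw [smul_smul, op_mul]
  have h : ∀ n : Fin 4, qB n • (reAverage x) = op (qB n) • reAverage x := by
    intro n
    fin_cases n
    · simp [qB]
    all_goals
      simp only [Fin.mk_one, Fin.reduceFinMk, reAverage, smul_comm _ (1 / 4 : ℝ) (_ : X), smul_sub,
        hc, hl, hr, h1, h2, h3, h4, h5, h6, h7, h8, h9, op_neg, op_one, neg_smul, one_smul,
        smul_neg, sub_neg_eq_add]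
      abel
  rw [quaternion_smul_eq, op_quaternion_smul_eq, h, h, h]

theorem reAverage_smul_eq_op_smul (α : ℍ) (x : X) :
    reAverage (α • x) = reAverage (op α • x) := by
  obtain ⟨h1, h2, h3, h4, h5, h6, h7, h8, h9⟩ := qB_mul_table
  have hc (a b : ℍ) (y : X) : op b • a • y = a • op b • y := (smul_comm a (op b) y).symm
  have hl (a b : ℍ) (y : X) : a • b • y = (a * b) • y := smul_smul a b y
  have hr (a b : ℍ) (y : X) : op a • op b • y = op (b * a) • y := by rw [smul_smul, op_mul]
  have h : ∀ n : Fin 4, reAverage (qB n • x) = reAverage (op (qB n) • x) := by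
    intro n
    fin_cases n
    · simp [qB]
    all_goals
      simp only [Fin.mk_one, Fin.reduceFinMk, reAverage, hc, hl,
        hr, h1, h2, h3, h4, h5, h6, h7, h8, h9, op_neg, op_one, neg_smul, one_smul,
        smul_neg, sub_neg_eq_add]
      congr 1
      abel
  rw [quaternion_smul_eq, op_quaternion_smul_eq]
  simp only [reAverage_add, reAverage_smul, h]

/-- `reAverage` as a linear projection onto the real part. -/
noncomputable def reProj : X →ₗ[ℝ] reSub X where
  toFun x := ⟨reAverage x, reAverage_mem x⟩
  map_add' x y := Subtype.ext (reAverage_add x y)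
  map_smul' r x := Subtype.ext (reAverage_smul r x)

theorem reProj_coe (z : reSub X) : reProj (z : X) = z :=
  Subtype.ext (reAverage_of_mem z.2)

theorem reProj_smul_eq_op_smul (α : ℍ) (x : X) : reProj (α • x) = reProj (op α • x) :=
  Subtype.ext (reAverage_smul_eq_op_smul α x)

theorem norm_reProj_le (hb : ∀ (α β : ℍ) (x : X), ‖α • op β • x‖ ≤ ‖α‖ * ‖x‖ * ‖β‖) (x : X) :
    ‖reProj x‖ ≤ ‖x‖ :=
  norm_reAverage_le hb x

/-- The `ℍ`-valued extension of a real functional on the real part. -/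
noncomputable def quatExtend (f : reSub X →L[ℝ] ℝ) : X →ₗ[ℝ] ℍ where
  toFun x := f (reProj x) • qB 0 - f (reProj (qB 1 • x)) • qB 1 - f (reProj (qB 2 • x)) • qB 2
    - f (reProj (qB 3 • x)) • qB 3
  map_add' x y := by
    simp only [smul_add, map_add]
    module
  map_smul' r x := by
    simp only [smul_comm _ r, map_smul, smul_eq_mul, RingHom.id_apply]
    module

theorem re_mul_quatExtend (f : reSub X →L[ℝ] ℝ) (β : ℍ) (x : X) :
    (β * quatExtend f x).re = f (reProj (β • x)) := by
  rw [quaternion_smul_eq β x]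
  simp [quatExtend]

theorem quatExtend_bimodule (f : reSub X →L[ℝ] ℝ) (α β : ℍ) (x : X) :
    quatExtend f (α • op β • x) = α * quatExtend f x * β := by
  apply quaternion_ext_re_mul
  intro γ
  have hcomm (p q : ℍ) : (p * q).re = (q * p).re := by simp; ring
  rw [re_mul_quatExtend, smul_smul, smul_comm, ← reProj_smul_eq_op_smul, smul_smul,
    ← re_mul_quatExtend, ← mul_assoc γ, hcomm _ β]
  simp only [mul_assoc]

theorem norm_le_of_re_mul_eq
    (hb : ∀ (α β : ℍ) (x : X), ‖α • op β • x‖ ≤ ‖α‖ * ‖x‖ * ‖β‖)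
    (f : reSub X →L[ℝ] ℝ) (x : X) (q : ℍ) (h : ∀ β : ℍ, (β * q).re = f (reProj (β • x))) :
    ‖q‖ ≤ ‖f‖ * ‖x‖ := by
  have hq : ‖q‖ * ‖q‖ = f (reProj (star q • x)) := by
    rw [← h, ← Quaternion.normSq_eq_norm_mul_self, Quaternion.star_mul_self]
    simp
  have hs : ‖star q • x‖ ≤ ‖q‖ * ‖x‖ := by simpa using hb (star q) 1 x
  have hle : ‖q‖ * ‖q‖ ≤ ‖q‖ * (‖f‖ * ‖x‖) := by
    calc ‖q‖ * ‖q‖ = f (reProj (star q • x)) := hq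
      _ ≤ ‖f‖ * ‖reProj (star q • x)‖ := (le_abs_self _).trans (f.le_opNorm _)
      _ ≤ ‖f‖ * (‖q‖ * ‖x‖) := by
        gcongr
        exact (norm_reProj_le hb _).trans hs
      _ = ‖q‖ * (‖f‖ * ‖x‖) := by ring
  rcases (norm_nonneg q).eq_or_lt with h0 | h0
  · rw [← h0]; positivity
  · exact le_of_mul_le_mul_left hle h0

theorem re_mul_bimodCLM (T : bimodCLM X) (β : ℍ) (x : X) :
    (β * (T : X →L[ℝ] ℍ) x).re = reRestrict T (reProj (β • x)) := by
  rw [reRestrict_apply, ← bimodCLM_smul]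
  change _ = ((T : X →L[ℝ] ℍ) (reAverage (β • x))).re
  rw [bimodCLM_reAverage, Quaternion.re_coe]

theorem norm_reRestrict (hb : ∀ (α β : ℍ) (x : X), ‖α • op β • x‖ ≤ ‖α‖ * ‖x‖ * ‖β‖)
    (T : bimodCLM X) : ‖reRestrict T‖ = ‖(T : X →L[ℝ] ℍ)‖ := by
  apply le_antisymm
  · refine ContinuousLinearMap.opNorm_le_bound _ (ContinuousLinearMap.opNorm_nonneg _) fun z => ?_
    rw [← Quaternion.norm_coe, ← bimodCLM_apply_coe]
    exact (T : X →L[ℝ] ℍ).le_opNorm z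
  · exact ContinuousLinearMap.opNorm_le_bound _ (ContinuousLinearMap.opNorm_nonneg _) fun x =>
      norm_le_of_re_mul_eq hb _ x _ fun β => re_mul_bimodCLM T β x

theorem reRestrict_surjective
    (hb : ∀ (α β : ℍ) (x : X), ‖α • op β • x‖ ≤ ‖α‖ * ‖x‖ * ‖β‖) :
    Function.Surjective (reRestrict (X := X)) := by
  intro f
  refine ⟨⟨(quatExtend f).mkContinuous ‖f‖ fun x =>
    norm_le_of_re_mul_eq hb f x _ fun β => re_mul_quatExtend f β x, quatExtend_bimodule f⟩, ?_⟩
  ext z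
  rw [reRestrict_apply]
  change (quatExtend f (z : X)).re = f z
  simp [quatExtend, reProj_coe]

end BimoduleRealPart

theorem stmt5 (X : Type*)
    [NormedAddCommGroup X] [NormedSpace ℝ X] [Module ℍ X] [Module ℍᵐᵒᵖ X]
    [IsScalarTower ℝ ℍ X] [IsScalarTower ℝ ℍᵐᵒᵖ X] [SMulCommClass ℍ ℍᵐᵒᵖ X]
    (hb : ∀ (α β : ℍ) (x : X), ‖α • op β • x‖ ≤ ‖α‖ * ‖x‖ * ‖β‖) :
    ∃ Ψ : ↥(bimodCLM X) →ₗ[ℝ] (↥(reSub X) →L[ℝ] ℝ),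
      (∀ (T : ↥(bimodCLM X)) (z : ↥(reSub X)),
        (T : X →L[ℝ] ℍ) (z : X) = (((Ψ T) z : ℝ) : ℍ)) ∧
      Function.Bijective Ψ ∧
      (∀ T : ↥(bimodCLM X), ‖Ψ T‖ = ‖(T : X →L[ℝ] ℍ)‖) := by
  refine ⟨reRestrict, bimodCLM_apply_coe, ⟨?_, reRestrict_surjective hb⟩, norm_reRestrict hb⟩
  rw [injective_iff_map_eq_zero]
  intro T hT
  ext x : 2
  refine quaternion_ext_re_mul fun β => ?_
  rw [re_mul_bimodCLM, hT]
  change (0 : ℝ) = (β * 0).re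
  rw [mul_zero, Quaternion.re_zero]
end

section
/- Let X be a Hilbert right ℍ-module and let π₁, π₂ be two unital ℝ-algebra homomorphisms from ℍ to the continuous ℝ-linear endomorphisms of X such that each π_k(α) is right ℍ-linear and ⟨π_k(α)x, y⟩ = ⟨x, π_k(star α)y⟩ for all α ∈ ℍ, x, y ∈ X (k = 1, 2). Then there exists a unitary U on X, i.e. a continuous ℝ-linear bijection which is right ℍ-linear and satisfies ⟨Ux, Uy⟩ = ⟨x, y⟩ for all x, y ∈ X, such that π₂(α) = U ∘ π₁(α) ∘ U⁻¹ for every α ∈ ℍ. -/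
open MulOpposite

local notation "ℍ" => Quaternion ℝ

section HilbertBasisCardinality

open Cardinal

variable {E : Type*} [NormedAddCommGroup E] [InnerProductSpace ℝ E]

theorem HilbertBasis.mk_le_of_infinite {ι κ : Type u} (b : HilbertBasis ι ℝ E)
    (c : HilbertBasis κ ℝ E) [Infinite κ] : #ι ≤ #κ := by
  have hcount (k : κ) : {i | inner ℝ (b i) (c k) ≠ 0}.Countable := by
    have h := (b.orthonormal.inner_products_summable (c k)).countable_support
    refine h.mono fun i hi => ?_
    simpa [Function.mem_support] using hi
  have hcover : (⋃ k, {i | inner ℝ (b i) (c k) ≠ 0}) = Set.univ := by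
    refine Set.eq_univ_of_forall fun i => ?_
    by_contra hi
    simp only [Set.mem_iUnion, Set.mem_ofPred_eq, not_exists, not_not] at hi
    have h := c.tsum_inner_mul_inner (b i) (b i)
    simp [hi, b.orthonormal.1 i] at h
  calc #ι = #(⋃ k, {i | inner ℝ (b i) (c k) ≠ 0}) := by rw [hcover, mk_univ]
    _ ≤ #κ * ⨆ k, #{i | inner ℝ (b i) (c k) ≠ 0} := mk_iUnion_le _
    _ ≤ #κ * ℵ₀ := by
      gcongr
      exact ciSup_le' fun k => (hcount k).le_aleph0
    _ = #κ := mul_aleph0_eq (aleph0_le_mk κ)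

theorem HilbertBasis.mk_eq {ι κ : Type u} (b : HilbertBasis ι ℝ E)
    (c : HilbertBasis κ ℝ E) : #ι = #κ := by
  have finite_of_finite {ι κ : Type u} (b : HilbertBasis ι ℝ E) (c : HilbertBasis κ ℝ E)
      [Finite κ] : Finite ι := by
    cases nonempty_fintype κ
    have := c.toOrthonormalBasis.toBasis.finiteDimensional_of_finite
    exact b.orthonormal.linearIndependent.finite
  cases finite_or_infinite ι with
  | inl hι =>
    have hκ : Finite κ := finite_of_finite c b
    cases nonempty_fintype ι
    cases nonempty_fintype κ
    simpa using mk_eq_mk_of_basis b.toOrthonormalBasis.toBasis c.toOrthonormalBasis.toBasis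
  | inr hι =>
    have hκ : Infinite κ := by
      by_contra h
      rw [not_infinite_iff_finite] at h
      exact hι.not_finite (finite_of_finite b c)
    exact le_antisymm (b.mk_le_of_infinite c) (c.mk_le_of_infinite b)

theorem Cardinal.nonempty_equiv_of_prod_fin {ι κ : Type u} {n : ℕ} (hn : n ≠ 0)
    (h : #(ι × Fin n) = #(κ × Fin n)) : Nonempty (ι ≃ κ) := by
  rw [← Cardinal.eq]
  simp only [mk_prod, mk_fin, lift_natCast, lift_uzero] at h
  exact (mul_natCast_inj hn).mp h

end HilbertBasisCardinality

section QuaternionicPair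

variable {E : Type*} [NormedAddCommGroup E] [InnerProductSpace ℝ E]

/-- Two skew-adjoint anticommuting complex structures on a real inner product space. -/
structure IsQuaternionicPair (I J : E →L[ℝ] E) : Prop where
  sq_left : ∀ x, I (I x) = -x
  sq_right : ∀ x, J (J x) = -x
  anticomm : ∀ x, J (I x) = -I (J x)
  skew_left : ∀ x y, inner ℝ (I x) y = -inner ℝ x (I y)
  skew_right : ∀ x y, inner ℝ (J x) y = -inner ℝ x (J y)

/-- The two pairs of maps commute with each other. -/
structure PairsCommute (I J R S : E →L[ℝ] E) : Prop where
  left_left : ∀ x, I (R x) = R (I x)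
  left_right : ∀ x, I (S x) = S (I x)
  right_left : ∀ x, J (R x) = R (J x)
  right_right : ∀ x, J (S x) = S (J x)

/-- The quadruple `v, v i, v j, v i j` where `i, j` act through `R, S`. -/
def quaternionFrame (R S : E →L[ℝ] E) (v : E) : Fin 4 → E := ![v, R v, S v, S (R v)]

variable {I J R S : E →L[ℝ] E}

theorem inner_eq_zero_of_central (h : IsQuaternionicPair I J) (hR : IsQuaternionicPair R S)
    (hc : PairsCommute I J R S) {v w : E} (hv : I v = R v) (hv' : J v = S v)
    (hw : I w = R w) (hw' : J w = S w) :
    inner ℝ v (R w) = 0 ∧ inner ℝ v (S w) = 0 ∧ inner ℝ v (R (S w)) = 0 := by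
  refine ⟨?_, ?_, ?_⟩
  · have h1 := h.skew_right v (S (R w))
    rw [hv', hR.skew_right, hc.right_right, hc.right_left, hw'] at h1
    simp only [hR.sq_right, hR.anticomm, inner_neg_right, map_neg, neg_neg] at h1
    linarith
  · have h1 := h.skew_left v (R (S w))
    rw [hv, hR.skew_left, hc.left_left, hc.left_right, hw] at h1
    simp only [hR.sq_left, hR.anticomm, inner_neg_right, map_neg, neg_neg] at h1
    linarith
  · have h1 := h.skew_left v (R (R (S w)))
    rw [hv, hR.skew_left, hc.left_left, hc.left_left, hc.left_right, hw] at h1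
    simp only [hR.sq_left, hR.anticomm, inner_neg_right, map_neg, neg_neg] at h1
    linarith

theorem orthonormal_quaternionFrame (h : IsQuaternionicPair I J) (hR : IsQuaternionicPair R S)
    (hc : PairsCommute I J R S) {ι : Type*} {v : ι → E} (hv : Orthonormal ℝ v)
    (hI : ∀ i, I (v i) = R (v i)) (hJ : ∀ i, J (v i) = S (v i)) :
    Orthonormal ℝ fun p : ι × Fin 4 => quaternionFrame R S (v p.1) p.2 := by
  classical
  rw [orthonormal_iff_ite] at hv ⊢
  rintro ⟨a, m⟩ ⟨b, n⟩
  obtain ⟨h1, h2, h3⟩ := inner_eq_zero_of_central h hR hc (hI a) (hJ a) (hI b) (hJ b)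
  fin_cases m <;> fin_cases n <;>
    simp [quaternionFrame, hR.skew_left, hR.skew_right, hR.sq_left, hR.sq_right, hR.anticomm,
      h1, h2, h3, hv]

/-- Up to a factor `4`, the projection onto the vectors on which `I = R` and `J = S`. -/
def centralize (I J R S : E →L[ℝ] E) (y : E) : E := y - I (R y) - J (S y) - I (J (S (R y)))

theorem left_centralize (h : IsQuaternionicPair I J) (hR : IsQuaternionicPair R S)
    (hc : PairsCommute I J R S) (y : E) :
    I (centralize I J R S y) = R (centralize I J R S y) := by
  simp only [centralize, map_sub, map_neg, h.sq_left, hR.sq_left, hR.anticomm, hc.left_left,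
    hc.left_right, hc.right_left, hc.right_right]
  abel

theorem right_centralize (h : IsQuaternionicPair I J) (hR : IsQuaternionicPair R S)
    (hc : PairsCommute I J R S) (y : E) :
    J (centralize I J R S y) = S (centralize I J R S y) := by
  simp only [centralize, map_sub, map_neg, h.sq_right, h.anticomm, hR.sq_right, hR.anticomm,
    hc.left_left, hc.left_right, hc.right_left, hc.right_right]
  abel

theorem inner_centralize (h : IsQuaternionicPair I J) (hR : IsQuaternionicPair R S)
    {v : E} (hv : I v = R v) (hv' : J v = S v) (hc : PairsCommute I J R S) (y : E) :
    inner ℝ (centralize I J R S y) v = 4 * inner ℝ y v := by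
  simp only [centralize, inner_sub_left, h.skew_left, h.skew_right, hR.skew_left, hR.skew_right,
    hv, hv', hc.right_left]
  simp only [hR.sq_left, hR.sq_right, hR.anticomm, inner_neg_right, map_neg, neg_neg]
  ring

theorem four_smul_eq_centralize (hR : IsQuaternionicPair R S)
    (hc : PairsCommute I J R S) (x : E) :
    (4 : ℝ) • x = centralize I J R S x - R (centralize I J R S (R x))
      - S (centralize I J R S (S x)) - S (R (centralize I J R S (S (R x)))) := by
  simp only [centralize, map_sub, map_neg, hR.sq_left, hR.sq_right, hR.anticomm, hc.left_left,
    hc.left_right, hc.right_left, hc.right_right]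
  module

theorem exists_hilbertBasis_quaternionFrame {E : Type u} [NormedAddCommGroup E]
    [InnerProductSpace ℝ E] [CompleteSpace E] {I J R S : E →L[ℝ] E}
    (h : IsQuaternionicPair I J) (hR : IsQuaternionicPair R S) (hc : PairsCommute I J R S) :
    ∃ (ι : Type u) (v : ι → E) (b : HilbertBasis (ι × Fin 4) ℝ E),
      (∀ i, I (v i) = R (v i)) ∧ (∀ i, J (v i) = S (v i)) ∧
        ∀ p, b p = quaternionFrame R S (v p.1) p.2 := by
  let K : Submodule ℝ E := (I - R).ker ⊓ (J - S).ker
  have hK (x : E) : x ∈ K ↔ I x = R x ∧ J x = S x := by simp [K, sub_eq_zero]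
  have hclosed : IsClosed (K : Set E) := (I - R).isClosed_ker.inter (J - S).isClosed_ker
  have : CompleteSpace K := hclosed.completeSpace_coe
  obtain ⟨w, b, hb⟩ := exists_hilbertBasis ℝ K
  let v : w → E := fun i => ((i : K) : E)
  have hv : Orthonormal ℝ v := by
    have := b.orthonormal.comp_linearIsometry K.subtypeₗᵢ
    rw [hb] at this
    exact this
  have hI (i : w) : I (v i) = R (v i) := ((hK _).mp (i : K).2).1
  have hJ (i : w) : J (v i) = S (v i) := ((hK _).mp (i : K).2).2
  have hon := orthonormal_quaternionFrame h hR hc hv hI hJ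
  have hperp : (Submodule.span ℝ
      (Set.range fun p : w × Fin 4 => quaternionFrame R S (v p.1) p.2))ᗮ = ⊥ := by
    rw [eq_bot_iff]
    intro x hx
    have hx' (i : w) (n : Fin 4) : inner ℝ x (quaternionFrame R S (v i) n) = 0 := by
      rw [real_inner_comm]
      exact (Submodule.mem_orthogonal _ _).mp hx _ (Submodule.subset_span ⟨(i, n), rfl⟩)
    have hzero (y : E) (hy : ∀ i, inner ℝ y (v i) = 0) : centralize I J R S y = 0 := by
      let z : K := ⟨centralize I J R S y,
        (hK _).mpr ⟨left_centralize h hR hc y, right_centralize h hR hc y⟩⟩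
      have hz : z = 0 := by
        apply b.repr.injective
        ext i
        rw [b.repr_apply_apply, hb, real_inner_comm, map_zero]
        change inner ℝ (centralize I J R S y) (v i) = 0
        rw [inner_centralize h hR (hI i) (hJ i) hc, hy, mul_zero]
      exact congrArg Subtype.val hz
    have h0 (i : w) := hx' i 0
    have h1 (i : w) := hx' i 1
    have h2 (i : w) := hx' i 2
    have h3 (i : w) := hx' i 3
    simp only [quaternionFrame, Matrix.cons_val] at h0 h1 h2 h3
    have h4 := four_smul_eq_centralize hR hc x
    rw [hzero x h0, hzero (R x) fun i => by rw [hR.skew_left, h1, neg_zero],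
      hzero (S x) fun i => by rw [hR.skew_right, h2, neg_zero],
      hzero (S (R x)) fun i => by
        have := h3 i
        rw [hR.anticomm, inner_neg_right] at this
        rw [hR.skew_right, hR.skew_left, neg_neg]
        linarith] at h4
    simpa using h4
  exact ⟨w, v, HilbertBasis.mkOfOrthogonalEqBot hon hperp, hI, hJ, fun p => by simp⟩

theorem exists_linearIsometryEquiv_intertwining {E : Type u} [NormedAddCommGroup E]
    [InnerProductSpace ℝ E] [CompleteSpace E] {I₁ J₁ I₂ J₂ R S : E →L[ℝ] E}
    (h₁ : IsQuaternionicPair I₁ J₁) (h₂ : IsQuaternionicPair I₂ J₂)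
    (hR : IsQuaternionicPair R S) (hc₁ : PairsCommute I₁ J₁ R S)
    (hc₂ : PairsCommute I₂ J₂ R S) :
    ∃ U : E ≃ₗᵢ[ℝ] E, (∀ x, U (R x) = R (U x)) ∧ (∀ x, U (S x) = S (U x)) ∧
      (∀ x, U (I₁ x) = I₂ (U x)) ∧ ∀ x, U (J₁ x) = J₂ (U x) := by
  obtain ⟨ι, v, b, hvI, hvJ, hb⟩ := exists_hilbertBasis_quaternionFrame h₁ hR hc₁
  obtain ⟨κ, w, c, hwI, hwJ, hc⟩ := exists_hilbertBasis_quaternionFrame h₂ hR hc₂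
  obtain ⟨e⟩ := Cardinal.nonempty_equiv_of_prod_fin four_ne_zero (b.mk_eq c)
  let f : ι × Fin 4 ≃ κ × Fin 4 := e.prodCongr (Equiv.refl _)
  let d : HilbertBasis (ι × Fin 4) ℝ E := HilbertBasis.mk (c.orthonormal.comp f f.injective)
    (by rw [f.surjective.range_comp, c.dense_span])
  let U : E ≃ₗᵢ[ℝ] E := b.repr.trans d.repr.symm
  have hU (i : ι) (n : Fin 4) :
      U (quaternionFrame R S (v i) n) = quaternionFrame R S (w (e i)) n := by
    classical
    have : U (b (i, n)) = d (i, n) := by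
      rw [← d.repr_symm_single, ← b.repr_self]
      rfl
    rw [hb, HilbertBasis.coe_mk] at this
    simpa [f, hc] using this
  have u0 (i : ι) := hU i 0
  have u1 (i : ι) := hU i 1
  have u2 (i : ι) := hU i 2
  have u3 (i : ι) := hU i 3
  simp only [quaternionFrame, Matrix.cons_val] at u0 u1 u2 u3
  have hRS (i : ι) : U (R (S (v i))) = R (S (w (e i))) := by
    simpa [hR.anticomm] using u3 i
  have key (A B : E →L[ℝ] E) (hAB : ∀ i n, U (A (quaternionFrame R S (v i) n))
      = B (quaternionFrame R S (w (e i)) n)) (x : E) : U (A x) = B (U x) := by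
    have hdense := Submodule.dense_iff_topologicalClosure_eq_top.mpr b.dense_span
    have := ContinuousLinearMap.ext_on (f := (U : E →L[ℝ] E).comp A)
      (g := B.comp (U : E →L[ℝ] E)) hdense (by
        rintro _ ⟨⟨i, n⟩, rfl⟩
        simpa [hb, hU] using hAB i n)
    exact congrArg (fun T : E →L[ℝ] E => T x) this
  refine ⟨U, key R R ?_, key S S ?_, key I₁ I₂ ?_, key J₁ J₂ ?_⟩
  all_goals
    intro i n
    fin_cases n <;>
      simp [quaternionFrame, hR.sq_left, hR.sq_right, hvI, hvJ, hwI, hwJ, hc₁.left_left,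
        hc₁.left_right, hc₁.right_left, hc₁.right_right, hc₂.left_left, hc₂.left_right,
        hc₂.right_left, hc₂.right_right, hR.anticomm, u0, u1, u2, hRS]

end QuaternionicPair

section Quaternion

/-- The imaginary unit `i`. -/
def Quaternion.unitI : ℍ := ⟨0, 1, 0, 0⟩

/-- The imaginary unit `j`. -/
def Quaternion.unitJ : ℍ := ⟨0, 0, 1, 0⟩

@[simp] theorem Quaternion.re_unitI : unitI.re = 0 := rfl
@[simp] theorem Quaternion.imI_unitI : unitI.imI = 1 := rfl
@[simp] theorem Quaternion.imJ_unitI : unitI.imJ = 0 := rfl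
@[simp] theorem Quaternion.imK_unitI : unitI.imK = 0 := rfl
@[simp] theorem Quaternion.re_unitJ : unitJ.re = 0 := rfl
@[simp] theorem Quaternion.imI_unitJ : unitJ.imI = 0 := rfl
@[simp] theorem Quaternion.imJ_unitJ : unitJ.imJ = 1 := rfl
@[simp] theorem Quaternion.imK_unitJ : unitJ.imK = 0 := rfl

theorem Quaternion.smul_one_eq_coe (r : ℝ) : r • (1 : ℍ) = r := by
  apply Quaternion.ext <;> simp

theorem Quaternion.unitI_mul_unitI : unitI * unitI = -1 := by
  apply Quaternion.ext <;> simp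

theorem Quaternion.unitJ_mul_unitJ : unitJ * unitJ = -1 := by
  apply Quaternion.ext <;> simp

theorem Quaternion.unitJ_mul_unitI : unitJ * unitI = -(unitI * unitJ) := by
  apply Quaternion.ext <;> simp

theorem Quaternion.star_unitI : star unitI = -unitI := by
  apply Quaternion.ext <;> simp

theorem Quaternion.star_unitJ : star unitJ = -unitJ := by
  apply Quaternion.ext <;> simp

theorem Quaternion.re_star_mul (p q : ℍ) : (star p * q).re = (q * star p).re := by
  simp only [Quaternion.re_mul]
  ring

theorem Quaternion.re_coe_mul (r : ℝ) (q : ℍ) : ((r : ℍ) * q).re = r * q.re := by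
  simp

theorem Quaternion.exists_eq_sum_basis (q : ℍ) : ∃ a b c d : ℝ,
    q = a • (1 : ℍ) + b • unitI + c • unitJ + d • (unitI * unitJ) := by
  refine ⟨q.re, q.imI, q.imJ, q.imK, ?_⟩
  apply Quaternion.ext <;> simp

theorem Quaternion.eq_of_re_mul_eq {p q : ℍ} (h : ∀ β : ℍ, (p * β).re = (q * β).re) : p = q := by
  have h0 := h 1
  have h1 := h unitI
  have h2 := h unitJ
  have h3 := h (unitI * unitJ)
  simp at h0 h1 h2 h3
  exact Quaternion.ext _ _ h0 h1 h2 h3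

/-- A linear map intertwining the actions of `1`, `i`, `j`, `i * j` intertwines the actions of
all quaternions. -/
theorem map_eq_of_map_basis_eq {X : Type*} [AddCommGroup X] [Module ℝ X] (U : X →ₗ[ℝ] X)
    (ρ σ : ℍ → X → X) (hρ_add : ∀ α β x, ρ (α + β) x = ρ α x + ρ β x)
    (hρ_smul : ∀ (r : ℝ) α x, ρ (r • α) x = r • ρ α x)
    (hσ_add : ∀ α β x, σ (α + β) x = σ α x + σ β x)
    (hσ_smul : ∀ (r : ℝ) α x, σ (r • α) x = r • σ α x)
    (h_one : ∀ x, U (ρ 1 x) = σ 1 (U x))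
    (h_i : ∀ x, U (ρ Quaternion.unitI x) = σ Quaternion.unitI (U x))
    (h_j : ∀ x, U (ρ Quaternion.unitJ x) = σ Quaternion.unitJ (U x))
    (h_k : ∀ x, U (ρ (Quaternion.unitI * Quaternion.unitJ) x)
      = σ (Quaternion.unitI * Quaternion.unitJ) (U x)) (α : ℍ) (x : X) :
    U (ρ α x) = σ α (U x) := by
  obtain ⟨a, b, c, d, rfl⟩ := α.exists_eq_sum_basis
  simp only [hρ_add, hρ_smul, hσ_add, hσ_smul, map_add, map_smul, h_one, h_i, h_j, h_k]

end Quaternion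

theorem stmt10 (X : Type*)
    [NormedAddCommGroup X] [NormedSpace ℝ X] [Module ℍᵐᵒᵖ X]
    [IsScalarTower ℝ ℍᵐᵒᵖ X] [CompleteSpace X]
    (inn : X → X → ℍ)
    (h_add_l : ∀ x y z : X, inn (x + y) z = inn x z + inn y z)
    (h_add_r : ∀ x y z : X, inn x (y + z) = inn x y + inn x z)
    (h_smul : ∀ (x y : X) (β : ℍ), inn x (op β • y) = inn x y * β)
    (h_star : ∀ x y : X, inn y x = star (inn x y))
    (h_pos : ∀ x : X, ∃ r : ℝ, 0 ≤ r ∧ inn x x = (r : ℍ))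
    (h_def : ∀ x : X, inn x x = 0 → x = 0)
    (h_norm : ∀ x : X, ‖x‖ = Real.sqrt ‖inn x x‖)
    (π₁ π₂ : ℍ →ₐ[ℝ] (X →L[ℝ] X))
    (h₁mod : ∀ (α β : ℍ) (x : X), π₁ α (op β • x) = op β • (π₁ α x))
    (h₁adj : ∀ (α : ℍ) (x y : X), inn (π₁ α x) y = inn x (π₁ (star α) y))
    (h₂mod : ∀ (α β : ℍ) (x : X), π₂ α (op β • x) = op β • (π₂ α x))
    (h₂adj : ∀ (α : ℍ) (x y : X), inn (π₂ α x) y = inn x (π₂ (star α) y)) :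
    ∃ U : X ≃L[ℝ] X,
      (∀ (β : ℍ) (x : X), U (op β • x) = op β • U x) ∧
      (∀ x y : X, inn (U x) (U y) = inn x y) ∧
      (∀ (α : ℍ) (x : X), π₂ α x = U (π₁ α (U.symm x))) := by
  have hzero_r (x : X) : inn x 0 = 0 := by simpa using h_add_r x 0 0
  have hsmul_real (r : ℝ) (x : X) : r • x = op (r : ℍ) • x := by
    rw [← one_smul ℍᵐᵒᵖ x, ← smul_assoc, ← mul_smul, mul_one]
    congr 1
    exact congrArg op (Quaternion.smul_one_eq_coe r)
  have hsmul_l (x y : X) (β : ℍ) : inn (op β • x) y = star β * inn x y := by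
    rw [h_star y, h_smul, star_mul, ← h_star]
  have hnorm_sq (x : X) : ‖x‖ ^ 2 = (inn x x).re := by
    obtain ⟨r, hr, hx⟩ := h_pos x
    rw [h_norm, Real.sq_sqrt (norm_nonneg _), hx, Quaternion.norm_coe, Real.norm_of_nonneg hr,
      Quaternion.re_coe]
  have hsmul_norm (β : ℍ) (x : X) : ‖op β • x‖ ≤ ‖β‖ * ‖x‖ := by
    have : ‖inn (op β • x) (op β • x)‖ = ‖β‖ ^ 2 * ‖inn x x‖ := by
      rw [hsmul_l, h_smul, norm_mul, norm_mul, norm_star]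
      ring
    rw [h_norm, h_norm, this, Real.sqrt_mul (sq_nonneg _), Real.sqrt_sq (norm_nonneg _)]
  let _ : InnerProductSpace ℝ X :=
    { ‹NormedSpace ℝ X› with
      inner := fun x y => (inn x y).re
      norm_sq_eq_re_inner := hnorm_sq
      conj_inner_symm := fun x y => by
        change (inn y x).re = (inn x y).re
        rw [h_star, Quaternion.re_star]
      add_left := fun x y z => by simp [h_add_l]
      smul_left := fun x y r => by
        change (inn (r • x) y).re = r * (inn x y).re
        rw [hsmul_real, hsmul_l]
        rw [Quaternion.star_coe, Quaternion.re_coe_mul] }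
  have hinner (x y : X) : inner ℝ x y = (inn x y).re := rfl
  let ρ (β : ℍ) : X →L[ℝ] X := LinearMap.mkContinuous
    { toFun := fun x => op β • x
      map_add' := smul_add _
      map_smul' := fun r x => by
        simp only [hsmul_real, RingHom.id_apply, ← mul_smul, ← op_mul]
        rw [Quaternion.coe_commutes] } ‖β‖ (hsmul_norm β)
  have hρ (β : ℍ) (x : X) : ρ β x = op β • x := rfl
  let qi : ℍ := Quaternion.unitI
  let qj : ℍ := Quaternion.unitJ
  have hii : qi * qi = -1 := Quaternion.unitI_mul_unitI
  have hjj : qj * qj = -1 := Quaternion.unitJ_mul_unitJ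
  have hji : qj * qi = -(qi * qj) := Quaternion.unitJ_mul_unitI
  have hi : star qi = -qi := Quaternion.star_unitI
  have hj : star qj = -qj := Quaternion.star_unitJ
  have hneg_r (x y : X) : inn x (-y) = -inn x y := by
    rw [eq_neg_iff_add_eq_zero, ← h_add_r, neg_add_cancel, hzero_r]
  have hpair (π : ℍ →ₐ[ℝ] (X →L[ℝ] X))
      (hadj : ∀ (α : ℍ) (x y : X), inn (π α x) y = inn x (π (star α) y)) :
      IsQuaternionicPair (π qi) (π qj) := by
    have hmul (α β : ℍ) (x : X) : π α (π β x) = π (α * β) x := by rw [map_mul]; rfl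
    refine ⟨fun x => ?_, fun x => ?_, fun x => ?_, fun x y => ?_, fun x y => ?_⟩
    · rw [hmul, hii, map_neg, map_one]; rfl
    · rw [hmul, hjj, map_neg, map_one]; rfl
    · rw [hmul, hmul, hji, map_neg]; rfl
    · rw [hinner, hinner, hadj, hi, map_neg]
      exact congrArg QuaternionAlgebra.re (hneg_r x _)
    · rw [hinner, hinner, hadj, hj, map_neg]
      exact congrArg QuaternionAlgebra.re (hneg_r x _)
  have hre_smul (β : ℍ) (x y : X) : (inn (op β • x) y).re = (inn x (op (star β) • y)).re := by
    rw [hsmul_l, h_smul, Quaternion.re_star_mul]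
  have hρpair : IsQuaternionicPair (ρ qi) (ρ qj) := by
    refine ⟨fun x => ?_, fun x => ?_, fun x => ?_, fun x y => ?_, fun x y => ?_⟩
    · rw [hρ, hρ, ← mul_smul, ← op_mul, hii, op_neg, op_one, neg_one_smul]
    · rw [hρ, hρ, ← mul_smul, ← op_mul, hjj, op_neg, op_one, neg_one_smul]
    · rw [hρ, hρ, hρ, hρ, ← mul_smul, ← op_mul, ← mul_smul, ← op_mul, hji, op_neg, neg_smul,
        neg_neg]
    · rw [hinner, hinner, hρ, hρ, hre_smul, hi, op_neg, neg_smul, hneg_r, Quaternion.re_neg]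
    · rw [hinner, hinner, hρ, hρ, hre_smul, hj, op_neg, neg_smul, hneg_r, Quaternion.re_neg]
  obtain ⟨U, hUi, hUj, hUI, hUJ⟩ := exists_linearIsometryEquiv_intertwining
    (hpair π₁ h₁adj) (hpair π₂ h₂adj) hρpair
    ⟨h₁mod qi qi, h₁mod qi qj, h₁mod qj qi, h₁mod qj qj⟩
    ⟨h₂mod qi qi, h₂mod qi qj, h₂mod qj qi, h₂mod qj qj⟩
  simp only [hρ] at hUi hUj
  have hUsmul : ∀ (β : ℍ) (x : X), U (op β • x) = op β • U x := by
    refine map_eq_of_map_basis_eq (U.toLinearEquiv : X →ₗ[ℝ] X) (fun β x => op β • x)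
      (fun β x => op β • x) (fun α β x => ?_) (fun r α x => ?_) (fun α β x => ?_)
      (fun r α x => ?_) (fun x => ?_) hUi hUj (fun x => ?_)
    · rw [op_add, add_smul]
    · rw [op_smul, smul_assoc]
    · rw [op_add, add_smul]
    · rw [op_smul, smul_assoc]
    · simp
    · change U (op (qi * qj) • x) = op (qi * qj) • U x
      rw [op_mul, mul_smul, mul_smul, hUj, hUi]
  have hUπ : ∀ (α : ℍ) (x : X), U (π₁ α x) = π₂ α (U x) := by
    refine map_eq_of_map_basis_eq (U.toLinearEquiv : X →ₗ[ℝ] X) (fun β x => π₁ β x)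
      (fun β x => π₂ β x) (fun α β x => ?_) (fun r α x => ?_) (fun α β x => ?_)
      (fun r α x => ?_) (fun x => ?_) hUI hUJ (fun x => ?_)
    · rw [map_add]; rfl
    · rw [map_smul]; rfl
    · rw [map_add]; rfl
    · rw [map_smul]; rfl
    · rw [map_one, map_one]; rfl
    · change U (π₁ (qi * qj) x) = π₂ (qi * qj) (U x)
      rw [map_mul, map_mul]
      change U (π₁ qi (π₁ qj x)) = π₂ qi (π₂ qj (U x))
      rw [hUI, hUJ]
  refine ⟨U.toContinuousLinearEquiv, hUsmul, fun x y => ?_, fun α x => ?_⟩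
  · refine Quaternion.eq_of_re_mul_eq fun β => ?_
    rw [← h_smul, ← h_smul]
    change (inn (U x) (op β • U y)).re = _
    rw [← hUsmul, ← hinner, U.inner_map_map, hinner]
  · change π₂ α x = U (π₁ α (U.symm x))
    rw [hUπ, U.apply_symm_apply]
end

section
/- Let X be an inner product ℍ-bimodule, with norm ‖x‖ := √‖⟨x,x⟩‖. Then for any family (x_e)_{e ∈ B} of elements of the real part X_Re, one has the Pythagorean identity ‖Σ_{e ∈ B} x_e • e‖² = Σ_{e ∈ B} ‖x_e‖². -/
open MulOpposite

local notation "ℍ" => Quaternion ℝ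

/-- A quaternion commuting with all quaternions is real. -/
theorem eq_coe_re_of_forall_commute {q : ℍ} (h : ∀ α : ℍ, q * α = α * q) : q = (q.re : ℍ) := by
  have h' (α : ℍ) := Quaternion.ext_iff.1 (h α)
  simp only [Quaternion.re_mul, Quaternion.imI_mul, Quaternion.imJ_mul, Quaternion.imK_mul] at h'
  have hi := h' ⟨0, 1, 0, 0⟩
  have hj := h' ⟨0, 0, 1, 0⟩
  dsimp only at hi hj
  ext <;> simp <;> linarith

theorem re_star_mul_coe_mul (r : ℝ) (a b : ℍ) :
    (star a * (r : ℍ) * b).re =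
      r * (a.re * b.re + a.imI * b.imI + a.imJ * b.imJ + a.imK * b.imK) := by
  simp
  ring

theorem re_star_qB_mul_coe_mul_qB (r : ℝ) (i j : Fin 4) :
    (star (qB i) * (r : ℍ) * qB j).re = if i = j then r else 0 := by
  have hq : qB = ![⟨1, 0, 0, 0⟩, ⟨0, 1, 0, 0⟩, ⟨0, 0, 1, 0⟩, ⟨0, 0, 0, 1⟩] := rfl
  rw [re_star_mul_coe_mul, hq]
  fin_cases i <;> fin_cases j <;> simp

theorem stmt13 (X : Type*)
    [NormedAddCommGroup X] [Module ℝ X] [Module ℍ X] [Module ℍᵐᵒᵖ X]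
    [IsScalarTower ℝ ℍ X] [IsScalarTower ℝ ℍᵐᵒᵖ X] [SMulCommClass ℍ ℍᵐᵒᵖ X]
    (inn : X → X → ℍ)
    (h_add_l : ∀ x y z : X, inn (x + y) z = inn x z + inn y z)
    (h_add_r : ∀ x y z : X, inn x (y + z) = inn x y + inn x z)
    (h_smul : ∀ (x y : X) (β : ℍ), inn x (op β • y) = inn x y * β)
    (h_star : ∀ x y : X, inn y x = star (inn x y))
    (h_pos : ∀ x : X, ∃ r : ℝ, 0 ≤ r ∧ inn x x = (r : ℍ))
    (h_def : ∀ x : X, inn x x = 0 → x = 0)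
    (h_norm : ∀ x : X, ‖x‖ = Real.sqrt ‖inn x x‖)
    (h_compat : ∀ (α : ℍ) (x y : X), inn (α • x) y = inn x ((star α) • y))
    (x : Fin 4 → X) (hx : ∀ e, x e ∈ reSet X) :
    ‖∑ e : Fin 4, op (qB e) • x e‖ ^ 2 = ∑ e : Fin 4, ‖x e‖ ^ 2 := by
  have norm_sq (y : X) : ‖y‖ ^ 2 = (inn y y).re := by
    obtain ⟨r, hr, h⟩ := h_pos y
    rw [h_norm, Real.sq_sqrt (norm_nonneg _), h, Quaternion.norm_coe, Real.norm_of_nonneg hr,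
      Quaternion.re_coe]
  have smul_left (β : ℍ) (y z : X) : inn (op β • y) z = star β * inn y z := by
    rw [h_star z, h_smul, star_mul, ← h_star]
  have real (i j : Fin 4) : inn (x i) (x j) = ((inn (x i) (x j)).re : ℍ) := by
    refine eq_coe_re_of_forall_commute fun α => ?_
    have h := h_compat (star α) (x i) (x j)
    rw [hx i, smul_left, star_star, hx j, h_smul] at h
    exact h.symm
  have sum_left (f : Fin 4 → X) (z : X) : inn (∑ i, f i) z = ∑ i, inn (f i) z :=
    map_sum (AddMonoidHom.mk' (fun y => inn y z) fun a b => h_add_l a b z) f Finset.univ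
  have sum_right (z : X) (f : Fin 4 → X) : inn z (∑ i, f i) = ∑ i, inn z (f i) :=
    map_sum (AddMonoidHom.mk' (inn z) (h_add_r z)) f Finset.univ
  have re_sum (f : Fin 4 → ℍ) : (∑ i, f i).re = ∑ i, (f i).re := by
    simp [Fin.sum_univ_four]
  have term (i j : Fin 4) : (inn (op (qB i) • x i) (op (qB j) • x j)).re =
      if i = j then (inn (x i) (x j)).re else 0 := by
    rw [h_smul, smul_left, real, re_star_qB_mul_coe_mul_qB, Quaternion.re_coe]
  simp [norm_sq, sum_left, sum_right, re_sum, term]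
end

section
/- Let X and Y be inner product ℍ-bimodules, each with norm ‖x‖ := √‖⟨x,x⟩‖. Then for every bounded ℍ-bimodule map T : X → Y (bounded ℝ-linear with T(α • x • β) = α • T(x) • β for all α, β ∈ ℍ), the operator norm of T equals the operator norm of its restriction T|_{X_Re} : X_Re → Y_Re; in particular the restriction map is an isometry from the space of bounded ℍ-bimodule maps X → Y onto the space of bounded ℝ-linear maps X_Re → Y_Re. -/
open MulOpposite

local notation "ℍ" => Quaternion ℝ

/-- The standard real basis `1, i, j, k` of the quaternions. -/
def quatUnit (a : Fin 4) : ℍ where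
  re := if a = 0 then 1 else 0
  imI := if a = 1 then 1 else 0
  imJ := if a = 2 then 1 else 0
  imK := if a = 3 then 1 else 0

@[simp]
lemma re_quatUnit (a : Fin 4) : (quatUnit a).re = if a = 0 then 1 else 0 := rfl

@[simp]
lemma imI_quatUnit (a : Fin 4) : (quatUnit a).imI = if a = 1 then 1 else 0 := rfl

@[simp]
lemma imJ_quatUnit (a : Fin 4) : (quatUnit a).imJ = if a = 2 then 1 else 0 := rfl

@[simp]
lemma imK_quatUnit (a : Fin 4) : (quatUnit a).imK = if a = 3 then 1 else 0 := rfl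

lemma sum_re_smul_quatUnit (q : ℍ) :
    ∑ b, (star (quatUnit b) * q).re • quatUnit b = q := by
  ext <;> simp [Fin.sum_univ_four]

lemma sum_re_smul_star_quatUnit (q : ℍ) :
    ∑ a, (q * quatUnit a).re • star (quatUnit a) = q := by
  ext <;> simp [Fin.sum_univ_four]

lemma sum_quatUnit_mul_star (q : ℍ) :
    ∑ a, quatUnit a * q * star (quatUnit a) = (4 * q.re) • (1 : ℍ) := by
  ext <;> simp [Fin.sum_univ_four, Quaternion.re_one, Quaternion.imI_one,
    Quaternion.imJ_one, Quaternion.imK_one] <;> ring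

lemma star_quatUnit_mul_re (a b : Fin 4) :
    (star (quatUnit a) * quatUnit b).re = if a = b then 1 else 0 := by
  fin_cases a <;> fin_cases b <;> simp

section Bimodule

variable {X : Type*} [AddCommGroup X] [Module ℝ X] [Module ℍ X] [Module ℍᵐᵒᵖ X]
  [IsScalarTower ℝ ℍ X] [IsScalarTower ℝ ℍᵐᵒᵖ X] [SMulCommClass ℍ ℍᵐᵒᵖ X]

lemma op_smul_smul_of_mem {z : X} (hz : z ∈ reSub X) (β q : ℍ) :
    op β • q • z = (q * β) • z := by
  rw [← smul_comm q, ← hz β, smul_smul]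

/-- Conjugation by the units averages an element of a bimodule into the real part. -/
lemma sum_quatUnit_conj_mem (x : X) :
    ∑ a, quatUnit a • op (star (quatUnit a)) • x ∈ reSub X := by
  intro α
  have h1 (a : Fin 4) : α • quatUnit a • op (star (quatUnit a)) • x =
      ∑ b, (star (quatUnit b) * (α * quatUnit a)).re •
        quatUnit b • op (star (quatUnit a)) • x := by
    rw [smul_smul]
    nth_rewrite 1 [← sum_re_smul_quatUnit (α * quatUnit a)]
    simp only [Finset.sum_smul, smul_assoc]
  have h2 (b : Fin 4) : op α • quatUnit b • op (star (quatUnit b)) • x =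
      ∑ a, (star (quatUnit b) * (α * quatUnit a)).re •
        quatUnit b • op (star (quatUnit a)) • x := by
    rw [← smul_comm (quatUnit b), smul_smul (op α), ← op_mul]
    nth_rewrite 1 [← sum_re_smul_star_quatUnit (star (quatUnit b) * α)]
    simp only [Finset.op_sum, Finset.sum_smul, op_smul, smul_assoc, Finset.smul_sum, mul_assoc]
    exact Finset.sum_congr rfl fun a _ => smul_comm _ _ _
  rw [Finset.smul_sum, Finset.smul_sum, Finset.sum_congr rfl fun a _ => h1 a,
    Finset.sum_congr rfl fun b _ => h2 b, Finset.sum_comm]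

/-- The projection of an `ℍ`-bimodule onto its real part. -/
noncomputable def rePart (X : Type*) [AddCommGroup X] [Module ℝ X] [Module ℍ X] [Module ℍᵐᵒᵖ X]
    [IsScalarTower ℝ ℍ X] [IsScalarTower ℝ ℍᵐᵒᵖ X] [SMulCommClass ℍ ℍᵐᵒᵖ X] :
    X →ₗ[ℝ] reSub X where
  toFun x := ⟨(1 / 4 : ℝ) • ∑ a, quatUnit a • op (star (quatUnit a)) • x,
    (reSub X).smul_mem _ (sum_quatUnit_conj_mem x)⟩
  map_add' x y := by
    ext
    simp only [smul_add, Finset.sum_add_distrib, Submodule.coe_add]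
  map_smul' r x := by
    ext
    simp only [RingHom.id_apply, Submodule.coe_smul]
    rw [smul_comm r, Finset.smul_sum (r := r)]
    congr 1
    refine Finset.sum_congr rfl fun a _ => ?_
    rw [smul_comm r (quatUnit a), smul_comm r (op (star (quatUnit a)))]

lemma coe_rePart (x : X) :
    (rePart X x : X) = (1 / 4 : ℝ) • ∑ a, quatUnit a • op (star (quatUnit a)) • x := rfl

lemma rePart_smul (q : ℍ) (z : reSub X) : rePart X (q • (z : X)) = q.re • z := by
  ext
  have h : ∑ a, quatUnit a • op (star (quatUnit a)) • q • (z : X) = (4 * q.re) • (z : X) := by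
    simp_rw [op_smul_smul_of_mem z.2, smul_smul, ← mul_assoc, ← Finset.sum_smul,
      sum_quatUnit_mul_star, smul_assoc, one_smul]
  rw [coe_rePart, h, smul_smul, Submodule.coe_smul]
  congr 1
  ring

lemma sum_quatUnit_smul_rePart (x : X) :
    ∑ b, quatUnit b • (rePart X (star (quatUnit b) • x) : X) = x := by
  have h (a : Fin 4) : ∑ b, quatUnit b • quatUnit a • op (star (quatUnit a)) •
      star (quatUnit b) • x = (4 * (quatUnit a).re) • op (star (quatUnit a)) • x := by
    simp_rw [← smul_comm _ (op (star (quatUnit a))), smul_smul, ← mul_assoc, ← Finset.sum_smul,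
      sum_quatUnit_mul_star, smul_assoc, one_smul]
  have h4 : (∑ b, quatUnit b • (rePart X (star (quatUnit b) • x) : X)) =
      (1 / 4 : ℝ) • ∑ a, ∑ b, quatUnit b • quatUnit a • op (star (quatUnit a)) •
        star (quatUnit b) • x := by
    rw [Finset.sum_comm, Finset.smul_sum]
    refine Finset.sum_congr rfl fun b _ => ?_
    rw [coe_rePart, smul_comm, Finset.smul_sum]
  have h1 : op (star (quatUnit 0)) • x = x := by
    have : star (quatUnit 0) = 1 := by
      ext <;> simp [Quaternion.re_one, Quaternion.imI_one,
        Quaternion.imJ_one, Quaternion.imK_one]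
    rw [this, op_one, one_smul]
  rw [h4, Finset.sum_congr rfl fun a _ => h a, Fin.sum_univ_four, h1]
  simp [smul_smul]

/-- Two additive maps that agree on quaternionic multiples of real elements are equal. -/
lemma addMonoidHom_ext_of_smul_reSub {M : Type*} [AddCommMonoid M] {f g : X →+ M}
    (h : ∀ (q : ℍ) (z : reSub X), f (q • (z : X)) = g (q • (z : X))) : f = g := by
  ext x
  rw [← sum_quatUnit_smul_rePart x, map_sum, map_sum]
  exact Finset.sum_congr rfl fun b _ => h _ _

variable {Y : Type*} [AddCommGroup Y] [Module ℝ Y] [Module ℍ Y] [Module ℍᵐᵒᵖ Y]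
  [IsScalarTower ℝ ℍ Y] [IsScalarTower ℝ ℍᵐᵒᵖ Y]

/-- The extension of a real-linear map between real parts to the whole bimodules. -/
noncomputable def reExtend (S : reSub X →ₗ[ℝ] reSub Y) : X →ₗ[ℝ] Y where
  toFun x := ∑ b, quatUnit b • (S (rePart X (star (quatUnit b) • x)) : Y)
  map_add' x y := by
    simp only [smul_add, map_add, Submodule.coe_add, Finset.sum_add_distrib]
  map_smul' r x := by
    rw [RingHom.id_apply, Finset.smul_sum]
    refine Finset.sum_congr rfl fun b _ => ?_
    rw [smul_comm _ r x, map_smul, map_smul, Submodule.coe_smul, smul_comm]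

lemma reExtend_apply (S : reSub X →ₗ[ℝ] reSub Y) (x : X) :
    reExtend S x = ∑ b, quatUnit b • (S (rePart X (star (quatUnit b) • x)) : Y) := rfl

lemma reExtend_smul_coe (S : reSub X →ₗ[ℝ] reSub Y) (q : ℍ) (z : reSub X) :
    reExtend S (q • (z : X)) = q • (S z : Y) := by
  nth_rewrite 2 [← sum_re_smul_quatUnit q]
  rw [reExtend_apply, Finset.sum_smul]
  refine Finset.sum_congr rfl fun b _ => ?_
  rw [smul_smul, rePart_smul, map_smul, Submodule.coe_smul, smul_comm, smul_assoc]

lemma reExtend_bimodule [SMulCommClass ℍ ℍᵐᵒᵖ Y] (S : reSub X →ₗ[ℝ] reSub Y) (α β : ℍ) (x : X) :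
    reExtend S (α • op β • x) = α • op β • reExtend S x := by
  have h : ((reExtend S).toAddMonoidHom.comp (DistribSMul.toAddMonoidHom X α)).comp
        (DistribSMul.toAddMonoidHom X (op β)) =
      ((DistribSMul.toAddMonoidHom Y α).comp (DistribSMul.toAddMonoidHom Y (op β))).comp
        (reExtend S).toAddMonoidHom := by
    refine addMonoidHom_ext_of_smul_reSub fun q z => ?_
    change reExtend S (α • op β • q • (z : X)) = α • op β • reExtend S (q • (z : X))
    rw [op_smul_smul_of_mem z.2, smul_smul, reExtend_smul_coe, reExtend_smul_coe,
      op_smul_smul_of_mem (S z).2, smul_smul]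
  exact DFunLike.congr_fun h x

end Bimodule

/-- The Pythagorean identity for the decomposition of an inner product `ℍ`-bimodule along
`1, i, j, k`. -/
lemma norm_sum_quatUnit_smul_sq {X : Type*} [NormedAddCommGroup X] [NormedSpace ℝ X]
    [Module ℍ X] [Module ℍᵐᵒᵖ X] [IsScalarTower ℝ ℍ X] [IsScalarTower ℝ ℍᵐᵒᵖ X]
    (inn : X → X → ℍ)
    (h_add_l : ∀ x y z : X, inn (x + y) z = inn x z + inn y z)
    (h_add_r : ∀ x y z : X, inn x (y + z) = inn x y + inn x z)
    (h_smul : ∀ (x y : X) (β : ℍ), inn x (op β • y) = inn x y * β)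
    (h_star : ∀ x y : X, inn y x = star (inn x y))
    (h_pos : ∀ x : X, ∃ r : ℝ, 0 ≤ r ∧ inn x x = (r : ℍ))
    (h_norm : ∀ x : X, ‖x‖ = Real.sqrt ‖inn x x‖)
    (h_compat : ∀ (α : ℍ) (x y : X), inn (α • x) y = inn x ((star α) • y))
    (z : Fin 4 → reSub X) :
    ‖∑ a, quatUnit a • (z a : X)‖ ^ 2 = ∑ a, ‖z a‖ ^ 2 := by
  have norm_sq (x : X) : ‖x‖ ^ 2 = (inn x x).re := by
    obtain ⟨r, hr, h⟩ := h_pos x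
    rw [h_norm, Real.sq_sqrt (norm_nonneg _), h, Quaternion.norm_coe, Quaternion.re_coe,
      Real.norm_of_nonneg hr]
  have smul_r (q : ℍ) (x : X) (w : reSub X) : inn x (q • (w : X)) = inn x w * q := by
    rw [w.2 q, h_smul]
  have real_smul (q : ℍ) (v w : reSub X) : star q * inn v w = inn v w * star q := by
    rw [← smul_r, ← h_compat, h_star w (q • (v : X)), smul_r, star_mul, ← h_star]
  have real_re (v w : reSub X) : inn v w = ((inn v w).re : ℍ) := by
    have hi := real_smul (quatUnit 1) v w
    have hj := real_smul (quatUnit 2) v w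
    have e1 := congrArg QuaternionAlgebra.imJ hi
    have e2 := congrArg QuaternionAlgebra.imK hi
    have e3 := congrArg QuaternionAlgebra.imK hj
    simp at e1 e2 e3
    ext <;> simp <;> linarith
  let L (y : X) : X →+ ℍ := AddMonoidHom.mk' (fun x => inn x y) fun a b => h_add_l a b y
  let R (x : X) : X →+ ℍ := AddMonoidHom.mk' (inn x) (h_add_r x)
  have sum_l (f : Fin 4 → X) (y : X) : inn (∑ a, f a) y = ∑ a, inn (f a) y := map_sum (L y) f _
  have sum_r (f : Fin 4 → X) (x : X) : inn x (∑ a, f a) = ∑ a, inn x (f a) := map_sum (R x) f _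
  have entry (a b : Fin 4) : (inn (quatUnit a • (z a : X)) (quatUnit b • (z b : X))).re =
      if a = b then ‖z a‖ ^ 2 else 0 := by
    rw [h_compat, smul_smul, smul_r, real_re, Quaternion.coe_mul_eq_smul, Quaternion.re_smul,
      star_quatUnit_mul_re, smul_eq_mul]
    split_ifs with hab
    · subst hab
      rw [mul_one, ← norm_sq, Submodule.coe_norm]
    · rw [mul_zero]
  have re_sum (f : Fin 4 → ℍ) : (∑ a, f a).re = ∑ a, (f a).re := by
    simp [Fin.sum_univ_four]
  rw [norm_sq, sum_l, re_sum]
  refine Finset.sum_congr rfl fun a _ => ?_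
  rw [sum_r, re_sum, Finset.sum_congr rfl fun b _ => entry a b]
  simp

theorem stmt14 (X Y : Type*)
    [NormedAddCommGroup X] [NormedSpace ℝ X] [Module ℍ X] [Module ℍᵐᵒᵖ X]
    [IsScalarTower ℝ ℍ X] [IsScalarTower ℝ ℍᵐᵒᵖ X] [SMulCommClass ℍ ℍᵐᵒᵖ X]
    [NormedAddCommGroup Y] [NormedSpace ℝ Y] [Module ℍ Y] [Module ℍᵐᵒᵖ Y]
    [IsScalarTower ℝ ℍ Y] [IsScalarTower ℝ ℍᵐᵒᵖ Y] [SMulCommClass ℍ ℍᵐᵒᵖ Y]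
    (innX : X → X → ℍ)
    (hX_add_l : ∀ x y z : X, innX (x + y) z = innX x z + innX y z)
    (hX_add_r : ∀ x y z : X, innX x (y + z) = innX x y + innX x z)
    (hX_smul : ∀ (x y : X) (β : ℍ), innX x (op β • y) = innX x y * β)
    (hX_star : ∀ x y : X, innX y x = star (innX x y))
    (hX_pos : ∀ x : X, ∃ r : ℝ, 0 ≤ r ∧ innX x x = (r : ℍ))
    (hX_def : ∀ x : X, innX x x = 0 → x = 0)
    (hX_norm : ∀ x : X, ‖x‖ = Real.sqrt ‖innX x x‖)
    (hX_compat : ∀ (α : ℍ) (x y : X), innX (α • x) y = innX x ((star α) • y))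
    (innY : Y → Y → ℍ)
    (hY_add_l : ∀ x y z : Y, innY (x + y) z = innY x z + innY y z)
    (hY_add_r : ∀ x y z : Y, innY x (y + z) = innY x y + innY x z)
    (hY_smul : ∀ (x y : Y) (β : ℍ), innY x (op β • y) = innY x y * β)
    (hY_star : ∀ x y : Y, innY y x = star (innY x y))
    (hY_pos : ∀ x : Y, ∃ r : ℝ, 0 ≤ r ∧ innY x x = (r : ℍ))
    (hY_def : ∀ x : Y, innY x x = 0 → x = 0)
    (hY_norm : ∀ x : Y, ‖x‖ = Real.sqrt ‖innY x x‖)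
    (hY_compat : ∀ (α : ℍ) (x y : Y), innY (α • x) y = innY x ((star α) • y)) :
    (∀ T : X →L[ℝ] Y, (∀ (α β : ℍ) (x : X), T (α • op β • x) = α • op β • T x) →
      ∃ S : ↥(reSub X) →L[ℝ] ↥(reSub Y),
        (∀ z : ↥(reSub X), (S z : Y) = T (z : X)) ∧ ‖S‖ = ‖T‖) ∧
    (∀ S : ↥(reSub X) →L[ℝ] ↥(reSub Y),
      ∃ T : X →L[ℝ] Y, (∀ (α β : ℍ) (x : X), T (α • op β • x) = α • op β • T x) ∧
        ∀ z : ↥(reSub X), (S z : Y) = T (z : X)) := by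
  have normX := norm_sum_quatUnit_smul_sq innX hX_add_l hX_add_r hX_smul hX_star hX_pos hX_norm
    hX_compat
  have normY := norm_sum_quatUnit_smul_sq innY hY_add_l hY_add_r hY_smul hY_star hY_pos hY_norm
    hY_compat
  have bound (S : reSub X →L[ℝ] reSub Y) (x : X) :
      ‖reExtend (S : reSub X →ₗ[ℝ] reSub Y) x‖ ≤ ‖S‖ * ‖x‖ := by
    refine le_of_sq_le_sq ?_ (by positivity)
    rw [reExtend_apply, normY, mul_pow]
    nth_rewrite 2 [← sum_quatUnit_smul_rePart x]
    rw [normX, Finset.mul_sum]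
    refine Finset.sum_le_sum fun b _ => ?_
    rw [← mul_pow]
    gcongr
    exact S.le_opNorm _
  refine ⟨fun T hT => ?_, fun S => ?_⟩
  · have hT_left (α : ℍ) (x : X) : T (α • x) = α • T x := by simpa using hT α 1 x
    have hT_right (β : ℍ) (x : X) : T (op β • x) = op β • T x := by simpa using hT 1 β x
    have hmem (z : reSub X) : T z ∈ reSub Y := fun α => by
      rw [← hT_left, z.2 α, hT_right]
    let S : reSub X →L[ℝ] reSub Y := (T.comp (reSub X).subtypeL).codRestrict (reSub Y) hmem
    have hS (x : X) : T x = reExtend (S : reSub X →ₗ[ℝ] reSub Y) x := by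
      nth_rewrite 1 [← sum_quatUnit_smul_rePart x]
      rw [map_sum, reExtend_apply]
      exact Finset.sum_congr rfl fun b _ => hT_left _ _
    refine ⟨S, fun z => rfl, le_antisymm ?_ ?_⟩
    · exact S.opNorm_le_bound (norm_nonneg T) fun z => T.le_opNorm z
    · exact T.opNorm_le_bound (norm_nonneg S) fun x => hS x ▸ bound S x
  · refine ⟨(reExtend (S : reSub X →ₗ[ℝ] reSub Y)).mkContinuous ‖S‖ (bound S),
      fun α β x => reExtend_bimodule _ α β x, fun z => ?_⟩
    simpa using (reExtend_smul_coe (S : reSub X →ₗ[ℝ] reSub Y) 1 z).symm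
end
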